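/- arXiv:2202.12794 — 2 statements merged into one kernel-verified Lean document; each statement's English description precedes it below -/
import Mathlib

section
/- Let u : ℝ³∖B̄₁ → ℝ satisfy ∫_{ℝ³∖B̄₁} |∇u|² < ∞ and Δu = 0 in ℝ³∖B̄₁. Then for all R ≥ 1, (1/R) ∫_{|x|≥R} |∇u|² ≤ (1/R²) ∫_{|x|≥1} |∇u|²; equivalently, ∫_{|x|≥R} |∇u|² ≤ (1/R) ∫_{|x|≥1} |∇u|². -/
open MeasureTheory Filter Metric Real
open scoped ENNReal NNReal Topology

noncomputable section

/-- Three-dimensional Euclidean space. -/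
abbrev E3 : Type := EuclideanSpace ℝ (Fin 3)

/-- The Laplacian `Δu = Σ_i ∂²_{ii} u` of a scalar function. -/
def lapR (u : E3 → ℝ) (x : E3) : ℝ :=
  ∑ i : Fin 3, iteratedFDeriv ℝ 2 u x (fun _ => EuclideanSpace.single i (1 : ℝ))

lemma norm_sq_dual_eq_sum (L : E3 →L[ℝ] ℝ) :
    ‖L‖ ^ 2 = ∑ i : Fin 3, L (EuclideanSpace.single i 1) ^ 2 := by
  set g : E3 := (InnerProductSpace.toDual ℝ E3).symm L with hg
  have hL : ∀ i : Fin 3, L (EuclideanSpace.single i 1) = g i := by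
    intro i
    rw [← InnerProductSpace.toDual_symm_apply (𝕜 := ℝ) (y := L), ← hg]
    simp [EuclideanSpace.inner_single_right]
  have hn : ‖L‖ = ‖g‖ := ((InnerProductSpace.toDual ℝ E3).symm.norm_map L).symm
  rw [hn, EuclideanSpace.norm_sq_eq]
  simp [hL]

lemma integral_fderiv_apply_eq_zero {F : E3 → ℝ} (hF : ContDiff ℝ 1 F) (hc : HasCompactSupport F)
    (v : E3) : Integrable (fun x => fderiv ℝ F x v) ∧ ∫ x, fderiv ℝ F x v = 0 := by
  have hint : Integrable (fun x => fderiv ℝ F x v) :=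
    ((hF.continuous_fderiv one_ne_zero).clm_apply continuous_const).integrable_of_hasCompactSupport
      (hc.fderiv_apply (𝕜 := ℝ) v)
  refine ⟨hint, ?_⟩
  have h := integral_mul_fderiv_eq_neg_fderiv_mul_of_integrable (𝕜 := ℝ) (μ := volume)
    (f := fun _ : E3 => (1 : ℝ)) (g := F) (v := v) (by simp) (by simpa using hint)
    (by simpa using hF.continuous.integrable_of_hasCompactSupport hc)
    (fun x _ => differentiableAt_const _) (fun x _ => hF.differentiable one_ne_zero x)
  simpa using h

lemma hasFDerivAt_norm_single {x : E3} (hx : x ≠ 0) :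
    ∃ N : E3 →L[ℝ] ℝ, HasFDerivAt (fun y : E3 => ‖y‖) N x ∧
      ∀ i : Fin 3, N (EuclideanSpace.single i 1) = x i / ‖x‖ := by
  have hd : DifferentiableAt ℝ (fun y : E3 => ‖y‖) x :=
    (contDiffAt_norm ℝ (n := 1) hx).differentiableAt one_ne_zero
  refine ⟨_, hd.hasFDerivAt, fun i => ?_⟩
  have h1 := (hd.hasFDerivAt.pow 2).unique (hasStrictFDerivAt_norm_sq x).hasFDerivAt
  have h2 := congrArg (fun L => L (EuclideanSpace.single i (1 : ℝ))) h1
  simp [EuclideanSpace.inner_single_right] at h2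
  have : ‖x‖ ≠ 0 := norm_ne_zero_iff.2 hx
  field_simp
  linarith

/-- The components of the vector field `η(|x|) (|∇u|² x - 2 (x·∇u) ∇u)`. -/
def pohozaevField (u : E3 → ℝ) (η : ℝ → ℝ) (i : Fin 3) (x : E3) : ℝ :=
  η ‖x‖ * (‖fderiv ℝ u x‖ ^ 2 * x i -
    2 * fderiv ℝ u x x * fderiv ℝ u x (EuclideanSpace.single i 1))

/-- The Pohozaev identity for a harmonic function, in pointwise form. -/
lemma sum_fderiv_pohozaevField {u : E3 → ℝ} {η : ℝ → ℝ} {x : E3} (hx : x ≠ 0)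
    (hu : ContDiffAt ℝ 2 u x) (hΔ : lapR u x = 0) (hη : DifferentiableAt ℝ η ‖x‖) :
    ∑ i : Fin 3, fderiv ℝ (pohozaevField u η i) x (EuclideanSpace.single i 1) =
      η ‖x‖ * ‖fderiv ℝ u x‖ ^ 2 +
        deriv η ‖x‖ / ‖x‖ * (‖x‖ ^ 2 * ‖fderiv ℝ u x‖ ^ 2 - 2 * fderiv ℝ u x x ^ 2) := by
  obtain ⟨N, hN, hNe⟩ := hasFDerivAt_norm_single hx
  set H := fderiv ℝ (fderiv ℝ u) x with hH
  have hdu : HasFDerivAt (fderiv ℝ u) H x :=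
    ((hu.fderiv_right (m := 1) (by norm_num)).differentiableAt one_ne_zero).hasFDerivAt
  have hp : ∀ v : E3, HasFDerivAt (fun y => fderiv ℝ u y v) (H.flip v) x := fun v => by
    simpa using hdu.clm_apply (hasFDerivAt_const v x)
  have hsymm : ∀ v w, H v w = H w v := fun v w =>
    (hu.isSymmSndFDerivAt (by simp)) v w
  have hx3 : ∀ y : E3, y = ∑ j : Fin 3, y j • EuclideanSpace.single j (1 : ℝ) := fun y => by
    ext k; fin_cases k <;> simp [Fin.sum_univ_three]
  have hpx : HasFDerivAt (fun y => fderiv ℝ u y y) (fderiv ℝ u x + H.flip x) x := by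
    simpa [ContinuousLinearMap.comp_id] using hdu.clm_apply (hasFDerivAt_id x)
  have hxi : ∀ i : Fin 3, HasFDerivAt (fun y : E3 => y i)
      (EuclideanSpace.proj i : E3 →L[ℝ] ℝ) x := fun i =>
    (EuclideanSpace.proj i : E3 →L[ℝ] ℝ).hasFDerivAt
  have hηx : HasFDerivAt (fun y : E3 => η ‖y‖) (deriv η ‖x‖ • N) x :=
    hη.hasDerivAt.comp_hasFDerivAt x hN
  have hW : HasFDerivAt (fun y => ‖fderiv ℝ u y‖ ^ 2)
      (∑ j : Fin 3, (2 * fderiv ℝ u x (EuclideanSpace.single j 1)) •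
        H.flip (EuclideanSpace.single j 1)) x := by
    simp_rw [norm_sq_dual_eq_sum]
    refine HasFDerivAt.fun_sum fun j _ => ?_
    simpa using (hp (EuclideanSpace.single j 1)).pow 2
  have key : ∀ i : Fin 3, fderiv ℝ (pohozaevField u η i) x (EuclideanSpace.single i 1) = _ :=
    fun i => congrArg (fun L => L (EuclideanSpace.single i (1 : ℝ)))
      (hηx.mul ((hW.mul (hxi i)).sub
        ((hpx.const_mul 2).mul (hp (EuclideanSpace.single i 1))))).fderiv
  have htr : ∑ i : Fin 3, H (EuclideanSpace.single i 1) (EuclideanSpace.single i 1) = 0 := by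
    simpa [lapR, iteratedFDeriv_two_apply] using hΔ
  simp only [key]
  have hr : ‖x‖ ≠ 0 := norm_ne_zero_iff.2 hx
  have hr2 : ‖x‖ ^ 2 = x 0 ^ 2 + x 1 ^ 2 + x 2 ^ 2 := by
    simp [EuclideanSpace.norm_sq_eq, Fin.sum_univ_three]
  have hDx : fderiv ℝ u x x = ∑ j : Fin 3, x j * fderiv ℝ u x (EuclideanSpace.single j 1) := by
    conv_lhs => arg 2; rw [hx3 x]
    simp [map_sum]
  have hHx : ∀ v, H v x = ∑ j : Fin 3, x j * H v (EuclideanSpace.single j 1) := fun v => by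
    conv_lhs => arg 2; rw [hx3 x]
    simp [map_sum]
  simp [Fin.sum_univ_three, hNe, norm_sq_dual_eq_sum, hHx, hDx] at htr ⊢
  rw [hsymm (EuclideanSpace.single 1 1) (EuclideanSpace.single 0 1),
    hsymm (EuclideanSpace.single 2 1) (EuclideanSpace.single 0 1),
    hsymm (EuclideanSpace.single 2 1) (EuclideanSpace.single 1 1)]
  rw [hr2]
  generalize H (EuclideanSpace.single 0 1) (EuclideanSpace.single 0 1) = q00 at *
  generalize H (EuclideanSpace.single 0 1) (EuclideanSpace.single 1 1) = q01 at *
  generalize H (EuclideanSpace.single 0 1) (EuclideanSpace.single 2 1) = q02 at *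
  generalize H (EuclideanSpace.single 1 1) (EuclideanSpace.single 1 1) = q11 at *
  generalize H (EuclideanSpace.single 1 1) (EuclideanSpace.single 2 1) = q12 at *
  generalize H (EuclideanSpace.single 2 1) (EuclideanSpace.single 2 1) = q22 at *
  obtain rfl : q22 = - q00 - q11 := by linarith
  field_simp
  ring

lemma contDiff_pohozaevField {u : E3 → ℝ} {η : ℝ → ℝ} {a : ℝ} (ha : 1 < a)
    (hreg : ContDiffOn ℝ 2 u {x : E3 | 1 < ‖x‖}) (hη : ContDiff ℝ 1 η)
    (hη0 : ∀ r ≤ a, η r = 0) (i : Fin 3) : ContDiff ℝ 1 (pohozaevField u η i) := by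
  rw [contDiff_iff_contDiffAt]
  intro x
  rcases lt_or_ge ‖x‖ a with hxa | hxa
  · have : pohozaevField u η i =ᶠ[𝓝 x] fun _ => 0 := by
      filter_upwards [(isOpen_lt continuous_norm continuous_const).mem_nhds hxa] with y hy
      simp [pohozaevField, hη0 _ (le_of_lt hy)]
    exact contDiffAt_const.congr_of_eventuallyEq this
  · have hx1 : 1 < ‖x‖ := ha.trans_le hxa
    have hx : x ≠ 0 := norm_pos_iff.1 (one_pos.trans hx1)
    have hu : ContDiffAt ℝ 2 u x :=
      hreg.contDiffAt ((isOpen_lt continuous_const continuous_norm).mem_nhds hx1)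
    have hdu : ContDiffAt ℝ 1 (fderiv ℝ u) x := hu.fderiv_right (by norm_num)
    have hp : ∀ v : E3, ContDiffAt ℝ 1 (fun y => fderiv ℝ u y v) x := fun v =>
      hdu.clm_apply contDiffAt_const
    have hW : ContDiffAt ℝ 1 (fun y => ‖fderiv ℝ u y‖ ^ 2) x := by
      simp_rw [norm_sq_dual_eq_sum]
      exact ContDiffAt.sum fun j _ => (hp _).pow 2
    have hxi : ContDiffAt ℝ 1 (fun y : E3 => y i) x :=
      (EuclideanSpace.proj i : E3 →L[ℝ] ℝ).contDiff.contDiffAt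
    exact (hη.contDiffAt.comp x (contDiffAt_norm ℝ hx)).mul
      ((hW.mul hxi).sub ((contDiffAt_const.mul (hdu.clm_apply contDiffAt_id)).mul (hp _)))

lemma integral_weight_mul_energy_le {u : E3 → ℝ} {η : ℝ → ℝ} {a b : ℝ} (ha : 1 < a)
    (hreg : ContDiffOn ℝ 2 u {x : E3 | 1 < ‖x‖})
    (hharm : ∀ x : E3, 1 < ‖x‖ → lapR u x = 0)
    (hW : IntegrableOn (fun x => ‖fderiv ℝ u x‖ ^ 2) {x : E3 | 1 < ‖x‖})
    (hη : ContDiff ℝ 1 η) (hη0 : ∀ r ≤ a, η r = 0) (hηb : ∀ r, b ≤ r → η r = 0) :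
    ∫ x in {x : E3 | 1 < ‖x‖}, η ‖x‖ * ‖fderiv ℝ u x‖ ^ 2 ≤
      ∫ x in {x : E3 | 1 < ‖x‖}, |‖x‖ * deriv η ‖x‖| * ‖fderiv ℝ u x‖ ^ 2 := by
  have hS : MeasurableSet {x : E3 | 1 < ‖x‖} := measurableSet_lt measurable_const measurable_norm
  have hcomp : ∀ {f : ℝ → ℝ}, (∀ r, b ≤ r → f r = 0) → (∀ r ≤ a, f r = 0) → HasCompactSupport f := by
    intro f hb h0
    refine HasCompactSupport.intro (isCompact_Icc (a := a) (b := b)) fun r hr => ?_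
    by_cases h : r ≤ a
    · exact h0 r h
    · exact hb r (by by_contra hb'; exact hr ⟨by linarith, by linarith⟩)
  have hηc : HasCompactSupport η := hcomp hηb hη0
  have hdc : Continuous (deriv η) := hη.continuous_deriv le_rfl
  have hXc : ∀ i, HasCompactSupport (pohozaevField u η i) := fun i =>
    HasCompactSupport.intro (isCompact_closedBall (0 : E3) b) fun x hx => by
      have : b ≤ ‖x‖ := by simpa using (le_of_lt (by simpa using hx))
      simp [pohozaevField, hηb _ this]
  have hX := fun i => contDiff_pohozaevField ha hreg hη hη0 i
  have hdiv : ∫ x in {x : E3 | 1 < ‖x‖},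
      ∑ i : Fin 3, fderiv ℝ (pohozaevField u η i) x (EuclideanSpace.single i 1) = 0 := by
    rw [setIntegral_eq_integral_of_forall_compl_eq_zero, integral_finsetSum]
    · simp [fun i => (integral_fderiv_apply_eq_zero (hX i) (hXc i) (EuclideanSpace.single i 1)).2]
    · exact fun i _ =>
        (integral_fderiv_apply_eq_zero (hX i) (hXc i) (EuclideanSpace.single i 1)).1
    · intro x hx
      have hxa : ‖x‖ < a := lt_of_le_of_lt (not_lt.1 hx) ha
      refine Finset.sum_eq_zero fun i _ => ?_
      have : pohozaevField u η i =ᶠ[𝓝 x] fun _ => 0 := by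
        filter_upwards [(isOpen_lt continuous_norm continuous_const).mem_nhds hxa] with y hy
        simp [pohozaevField, hη0 _ (le_of_lt hy)]
      simp [this.fderiv_eq]
  have hdivI : IntegrableOn (fun x : E3 =>
      ∑ i : Fin 3, fderiv ℝ (pohozaevField u η i) x (EuclideanSpace.single i 1))
      {x : E3 | 1 < ‖x‖} :=
    (integrable_finsetSum _ fun i _ =>
      (integral_fderiv_apply_eq_zero (hX i) (hXc i) (EuclideanSpace.single i 1)).1).integrableOn
  obtain ⟨C, hC⟩ := hηc.exists_bound_of_continuous hη.continuous
  have hwc : HasCompactSupport (fun r => r * deriv η r) := hηc.deriv.mul_left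
  obtain ⟨C', hC'⟩ := hwc.exists_bound_of_continuous (continuous_id.mul hdc)
  have hI1 : IntegrableOn (fun x : E3 => η ‖x‖ * ‖fderiv ℝ u x‖ ^ 2) {x : E3 | 1 < ‖x‖} :=
    hW.bdd_mul (hη.continuous.comp continuous_norm).aestronglyMeasurable
      (ae_of_all _ fun x => hC ‖x‖)
  have hI2 : IntegrableOn (fun x : E3 => |‖x‖ * deriv η ‖x‖| * ‖fderiv ℝ u x‖ ^ 2)
      {x : E3 | 1 < ‖x‖} :=
    hW.bdd_mul (c := C') (by fun_prop) (ae_of_all _ fun x => by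
      simpa using hC' ‖x‖)
  rw [← sub_nonpos, ← integral_sub hI1 hI2, ← hdiv]
  refine setIntegral_mono_on (hI1.sub hI2) hdivI hS fun x hx => ?_
  have hx1 : 1 < ‖x‖ := hx
  have hx0 : 0 < ‖x‖ := one_pos.trans hx1
  rw [sum_fderiv_pohozaevField (norm_pos_iff.1 hx0)
    (hreg.contDiffAt ((isOpen_lt continuous_const continuous_norm).mem_nhds hx1))
    (hharm x hx1) (hη.differentiable one_ne_zero _)]
  have hcs : fderiv ℝ u x x ^ 2 ≤ ‖x‖ ^ 2 * ‖fderiv ℝ u x‖ ^ 2 := by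
    rw [← mul_pow, sq_le_sq, abs_of_nonneg (a := ‖x‖ * _) (by positivity), mul_comm]
    exact (fderiv ℝ u x).le_opNorm x
  have habs : |‖x‖ ^ 2 * ‖fderiv ℝ u x‖ ^ 2 - 2 * fderiv ℝ u x x ^ 2| ≤
      ‖x‖ ^ 2 * ‖fderiv ℝ u x‖ ^ 2 := by
    rw [abs_le]
    constructor <;> nlinarith [sq_nonneg (fderiv ℝ u x x)]
  have h1 := neg_abs_le (deriv η ‖x‖ / ‖x‖ *
    (‖x‖ ^ 2 * ‖fderiv ℝ u x‖ ^ 2 - 2 * fderiv ℝ u x x ^ 2))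
  rw [abs_mul] at h1
  have h2 := mul_le_mul_of_nonneg_left habs (abs_nonneg (deriv η ‖x‖ / ‖x‖))
  have h3 : |deriv η ‖x‖ / ‖x‖| * (‖x‖ ^ 2 * ‖fderiv ℝ u x‖ ^ 2) =
      |‖x‖ * deriv η ‖x‖| * ‖fderiv ℝ u x‖ ^ 2 := by
    rw [abs_div, abs_mul, abs_of_pos hx0]
    field_simp
  linarith

/-- A smooth approximation of the indicator function of the interval `(1, R)`. -/
def bumpSlope (R : ℝ) (n : ℕ) (t : ℝ) : ℝ :=
  smoothTransition (n * (t - 1) - 1) * smoothTransition (n * (R - t))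

lemma continuous_bumpSlope (R : ℝ) (n : ℕ) : Continuous (bumpSlope R n) :=
  (smoothTransition.continuous.comp (by fun_prop)).mul
    (smoothTransition.continuous.comp (by fun_prop))

lemma bumpSlope_nonneg (R : ℝ) (n : ℕ) (t : ℝ) : 0 ≤ bumpSlope R n t :=
  mul_nonneg (smoothTransition.nonneg _) (smoothTransition.nonneg _)

lemma bumpSlope_le_one (R : ℝ) (n : ℕ) (t : ℝ) : bumpSlope R n t ≤ 1 :=
  mul_le_one₀ (smoothTransition.le_one _) (smoothTransition.nonneg _) (smoothTransition.le_one _)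

lemma bumpSlope_of_ge {R : ℝ} (n : ℕ) {t : ℝ} (h : R ≤ t) : bumpSlope R n t = 0 := by
  rw [bumpSlope, smoothTransition.zero_of_nonpos (x := n * (R - t)), mul_zero]
  exact mul_nonpos_of_nonneg_of_nonpos n.cast_nonneg (by linarith)

lemma bumpSlope_of_le {R : ℝ} {n : ℕ} {t : ℝ} (hn : 0 < n) (h : t ≤ 1 + 1 / n) :
    bumpSlope R n t = 0 := by
  rw [bumpSlope, smoothTransition.zero_of_nonpos, zero_mul]
  have hn' : (0 : ℝ) < n := by exact_mod_cast hn
  have : (n : ℝ) * (t - 1) ≤ n * (1 / n) := mul_le_mul_of_nonneg_left (by linarith) hn'.le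
  rw [mul_one_div_cancel hn'.ne'] at this
  linarith

lemma eventually_bumpSlope_eq {R t : ℝ} (ht : 1 < t) :
    ∀ᶠ n : ℕ in atTop, bumpSlope R n t = if t < R then 1 else 0 := by
  split_ifs with h
  · have h1 : Tendsto (fun n : ℕ => (n : ℝ) * (t - 1)) atTop atTop :=
      tendsto_natCast_atTop_atTop.atTop_mul_const (by linarith)
    have h2 : Tendsto (fun n : ℕ => (n : ℝ) * (R - t)) atTop atTop :=
      tendsto_natCast_atTop_atTop.atTop_mul_const (by linarith)
    filter_upwards [h1.eventually_ge_atTop 2, h2.eventually_ge_atTop 1] with n h1 h2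
    rw [bumpSlope, smoothTransition.one_of_one_le (by linarith),
      smoothTransition.one_of_one_le h2, mul_one]
  · exact Eventually.of_forall fun n => bumpSlope_of_ge n (not_lt.1 h)

/-- A `C¹` approximation of `r ↦ min r R - 1`. -/
def bumpRamp (R : ℝ) (n : ℕ) (r : ℝ) : ℝ := ∫ t in (1 : ℝ)..r, bumpSlope R n t

lemma hasDerivAt_bumpRamp (R : ℝ) (n : ℕ) (r : ℝ) :
    HasDerivAt (bumpRamp R n) (bumpSlope R n r) r :=
  (continuous_bumpSlope R n).integral_hasStrictDerivAt 1 r |>.hasDerivAt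

lemma bumpRamp_eq_min (R : ℝ) (n : ℕ) (r : ℝ) :
    bumpRamp R n r = ∫ t in (1 : ℝ)..min r R, bumpSlope R n t := by
  rcases le_total r R with h | h
  · rw [min_eq_left h, bumpRamp]
  · rw [min_eq_right h, bumpRamp, ← intervalIntegral.integral_add_adjacent_intervals
      ((continuous_bumpSlope R n).intervalIntegrable 1 R)
      ((continuous_bumpSlope R n).intervalIntegrable R r), add_eq_left]
    refine (intervalIntegral.integral_congr (g := fun _ => 0) fun t ht => ?_).trans (by simp)
    rw [Set.uIcc_of_le h] at ht
    exact bumpSlope_of_ge n ht.1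

lemma abs_bumpRamp_le {R r : ℝ} (hR : 1 ≤ R) (n : ℕ) (hr : 1 ≤ r) : |bumpRamp R n r| ≤ R := by
  rw [bumpRamp_eq_min]
  have h := intervalIntegral.norm_integral_le_of_norm_le_const (a := 1) (b := min r R) (C := 1)
    (f := bumpSlope R n) fun t _ => by
      rw [Real.norm_of_nonneg (bumpSlope_nonneg R n t)]; exact bumpSlope_le_one R n t
  have : 1 ≤ min r R := le_min hr hR
  rw [one_mul, abs_of_nonneg (by linarith)] at h
  exact h.trans (by linarith [min_le_right r R])

lemma bumpRamp_of_le {R : ℝ} {n : ℕ} {r : ℝ} (hn : 0 < n) (h : r ≤ 1 + 1 / n) :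
    bumpRamp R n r = 0 := by
  refine (intervalIntegral.integral_congr (g := fun _ => 0) fun t ht => ?_).trans (by simp)
  refine bumpSlope_of_le hn ?_
  rcases Set.mem_uIcc.1 ht with ht | ht
  · exact ht.2.trans h
  · have : (0 : ℝ) ≤ 1 / n := by positivity
    linarith [ht.2]

lemma tendsto_bumpRamp {R r : ℝ} (hR : 1 ≤ R) (hr : 1 ≤ r) :
    Tendsto (fun n => bumpRamp R n r) atTop (𝓝 (min r R - 1)) := by
  simp_rw [bumpRamp_eq_min]
  have h : ∫ _ in (1 : ℝ)..min r R, (1 : ℝ) = min r R - 1 := by simp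
  rw [← h]
  refine intervalIntegral.tendsto_integral_filter_of_dominated_convergence (fun _ => 1)
    (Eventually.of_forall fun n => (continuous_bumpSlope R n).aestronglyMeasurable)
    (Eventually.of_forall fun n => ae_of_all _ fun t _ => ?_) (by simp) ?_
  · rw [Real.norm_of_nonneg (bumpSlope_nonneg R n t)]; exact bumpSlope_le_one R n t
  · have hne : ∀ᵐ t : ℝ, t ≠ R := by simp [ae_iff]
    filter_upwards [hne] with t htR ht
    rw [Set.uIoc_of_le (le_min hr hR)] at ht
    have htR' : t < R := lt_of_le_of_ne (ht.2.trans (min_le_right _ _)) htR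
    refine tendsto_const_nhds.congr' ?_
    filter_upwards [eventually_bumpSlope_eq (R := R) ht.1] with n hn
    rw [hn, if_pos htR']

lemma deriv_smoothTransition_of_neg {t : ℝ} (h : t < 0) : deriv smoothTransition t = 0 := by
  have : smoothTransition =ᶠ[𝓝 t] fun _ => 0 := by
    filter_upwards [Iio_mem_nhds h] with s hs
    exact smoothTransition.zero_of_nonpos (le_of_lt hs)
  simp [this.deriv_eq]

lemma deriv_smoothTransition_of_one_lt {t : ℝ} (h : 1 < t) : deriv smoothTransition t = 0 := by
  have : smoothTransition =ᶠ[𝓝 t] fun _ => 1 := by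
    filter_upwards [Ioi_mem_nhds h] with s hs
    exact smoothTransition.one_of_one_le (le_of_lt hs)
  simp [this.deriv_eq]

lemma exists_abs_deriv_smoothTransition_le : ∃ C : ℝ, ∀ t, |deriv smoothTransition t| ≤ C := by
  have hs : HasCompactSupport (deriv smoothTransition) := by
    refine HasCompactSupport.intro (isCompact_Icc (a := (0 : ℝ)) (b := 1)) fun t ht => ?_
    rcases lt_or_ge t 0 with h | h
    · exact deriv_smoothTransition_of_neg h
    · exact deriv_smoothTransition_of_one_lt (lt_of_not_ge fun h1 => ht ⟨h, h1⟩)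
  exact hs.exists_bound_of_continuous
    ((smoothTransition.contDiff (n := 1)).continuous_deriv le_rfl)

/-- A compactly supported version of `bumpRamp`, cut off at the scale `n`. -/
def cutoffRamp (R : ℝ) (n : ℕ) (r : ℝ) : ℝ := bumpRamp R n r * smoothTransition (2 - r / n)

lemma hasDerivAt_cutoffRamp (R : ℝ) (n : ℕ) (r : ℝ) :
    HasDerivAt (cutoffRamp R n) (bumpSlope R n r * smoothTransition (2 - r / n) +
      bumpRamp R n r * (deriv smoothTransition (2 - r / n) * (-(1 / n)))) r := by
  have h1 : HasDerivAt (fun r : ℝ => 2 - r / (n : ℝ)) (-(1 / n)) r :=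
    ((hasDerivAt_id r).div_const (n : ℝ)).const_sub 2
  exact (hasDerivAt_bumpRamp R n r).mul
    (((smoothTransition.contDiff (n := 1)).differentiable one_ne_zero _).hasDerivAt.comp r h1)

lemma contDiff_cutoffRamp (R : ℝ) (n : ℕ) : ContDiff ℝ 1 (cutoffRamp R n) := by
  refine ContDiff.mul ?_ (smoothTransition.contDiff.comp (by fun_prop))
  rw [contDiff_one_iff_deriv]
  refine ⟨fun r => (hasDerivAt_bumpRamp R n r).differentiableAt, ?_⟩
  rw [funext fun r => (hasDerivAt_bumpRamp R n r).deriv]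
  exact continuous_bumpSlope R n

lemma cutoffRamp_of_le {R : ℝ} {n : ℕ} {r : ℝ} (hn : 0 < n) (h : r ≤ 1 + 1 / n) :
    cutoffRamp R n r = 0 := by
  rw [cutoffRamp, bumpRamp_of_le hn h, zero_mul]

lemma cutoffRamp_of_ge {R : ℝ} {n : ℕ} {r : ℝ} (hn : 0 < n) (h : 2 * n ≤ r) :
    cutoffRamp R n r = 0 := by
  have hn' : (0 : ℝ) < n := by exact_mod_cast hn
  rw [cutoffRamp, smoothTransition.zero_of_nonpos, mul_zero]
  rw [sub_nonpos, le_div_iff₀ hn']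
  exact h

lemma abs_cutoffRamp_le {R r : ℝ} (hR : 1 ≤ R) (n : ℕ) (hr : 1 ≤ r) : |cutoffRamp R n r| ≤ R := by
  rw [cutoffRamp, abs_mul, abs_of_nonneg (smoothTransition.nonneg _)]
  exact (mul_le_of_le_one_right (abs_nonneg _) (smoothTransition.le_one _)).trans
    (abs_bumpRamp_le hR n hr)

lemma abs_mul_deriv_cutoffRamp_le {R C r : ℝ} (hR : 1 ≤ R)
    (hC : ∀ t, |deriv smoothTransition t| ≤ C) {n : ℕ} (hn : 0 < n) (hr : 1 ≤ r) :
    |r * deriv (cutoffRamp R n) r| ≤ R + R * (C * 2) := by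
  have hn' : (0 : ℝ) < n := by exact_mod_cast hn
  have hC0 : 0 ≤ C := (abs_nonneg _).trans (hC 0)
  rw [(hasDerivAt_cutoffRamp R n r).deriv, mul_add]
  refine (abs_add_le _ _).trans (add_le_add ?_ ?_)
  · rcases le_or_gt R r with h | h
    · simp only [bumpSlope_of_ge n h, zero_mul, mul_zero, abs_zero]; linarith
    · rw [abs_mul, abs_of_nonneg (by linarith : 0 ≤ r),
        abs_of_nonneg (mul_nonneg (bumpSlope_nonneg _ _ _) (smoothTransition.nonneg _))]
      exact (mul_le_of_le_one_right (by linarith) (mul_le_one₀ (bumpSlope_le_one _ _ _)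
        (smoothTransition.nonneg _) (smoothTransition.le_one _))).trans h.le
  · have : r * (bumpRamp R n r * (deriv smoothTransition (2 - r / n) * (-(1 / n)))) =
        -(bumpRamp R n r * (deriv smoothTransition (2 - r / n) * (r / n))) := by ring
    rw [this, abs_neg, abs_mul]
    refine mul_le_mul (abs_bumpRamp_le hR n hr) ?_ (abs_nonneg _) (by linarith)
    rcases le_or_gt (r / n) 2 with h | h
    · rw [abs_mul, abs_of_nonneg (by positivity : 0 ≤ r / n)]
      exact mul_le_mul (hC _) h (by positivity) hC0
    · rw [deriv_smoothTransition_of_neg (by linarith), zero_mul, abs_zero]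
      positivity

lemma tendsto_cutoffRamp {R r : ℝ} (hR : 1 ≤ R) (hr : 1 ≤ r) :
    Tendsto (fun n => cutoffRamp R n r) atTop (𝓝 (min r R - 1)) := by
  refine (tendsto_bumpRamp hR hr).congr' ?_
  filter_upwards [tendsto_natCast_atTop_atTop.eventually_gt_atTop r] with n hn
  have : r / n ≤ 1 := (div_le_one (by linarith)).2 hn.le
  rw [cutoffRamp, smoothTransition.one_of_one_le (by linarith), mul_one]

lemma tendsto_abs_mul_deriv_cutoffRamp {R r : ℝ} (hr : 1 < r) :
    Tendsto (fun n => |r * deriv (cutoffRamp R n) r|) atTop (𝓝 (if r < R then r else 0)) := by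
  refine tendsto_const_nhds.congr' ?_
  filter_upwards [tendsto_natCast_atTop_atTop.eventually_gt_atTop r,
    eventually_bumpSlope_eq (R := R) hr] with n hn hs
  have : r / n < 1 := (div_lt_one (by linarith)).2 hn
  rw [(hasDerivAt_cutoffRamp R n r).deriv, hs, smoothTransition.one_of_one_le (by linarith),
    deriv_smoothTransition_of_one_lt (by linarith)]
  split_ifs
  · simp [abs_of_pos (one_pos.trans hr)]
  · simp

lemma mul_setIntegral_energy_le {u : E3 → ℝ} {R : ℝ} (hR : 1 ≤ R)
    (hreg : ContDiffOn ℝ 2 u {x : E3 | 1 < ‖x‖})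
    (hharm : ∀ x : E3, 1 < ‖x‖ → lapR u x = 0)
    (hW : IntegrableOn (fun x => ‖fderiv ℝ u x‖ ^ 2) {x : E3 | 1 < ‖x‖}) :
    R * ∫ x in {x : E3 | 1 < ‖x‖} ∩ {x | R ≤ ‖x‖}, ‖fderiv ℝ u x‖ ^ 2 ≤
      ∫ x in {x : E3 | 1 < ‖x‖}, ‖fderiv ℝ u x‖ ^ 2 := by
  have hS : MeasurableSet {x : E3 | 1 < ‖x‖} := measurableSet_lt measurable_const measurable_norm
  have hT : MeasurableSet {x : E3 | R ≤ ‖x‖} := measurableSet_le measurable_const measurable_norm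
  obtain ⟨C, hC⟩ := exists_abs_deriv_smoothTransition_le
  have hWm := hW.aestronglyMeasurable
  have hmin : Measurable fun x : E3 => min ‖x‖ R - 1 := by fun_prop
  have hind : Measurable fun x : E3 => if ‖x‖ < R then ‖x‖ else 0 :=
    Measurable.ite (measurableSet_lt measurable_norm measurable_const) measurable_norm
      measurable_const
  have hlim1 : Tendsto (fun n : ℕ => ∫ x in {x : E3 | 1 < ‖x‖},
      cutoffRamp R n ‖x‖ * ‖fderiv ℝ u x‖ ^ 2) atTop
      (𝓝 (∫ x in {x : E3 | 1 < ‖x‖}, (min ‖x‖ R - 1) * ‖fderiv ℝ u x‖ ^ 2)) := by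
    refine tendsto_integral_filter_of_dominated_convergence
      (fun x => R * ‖fderiv ℝ u x‖ ^ 2) (Eventually.of_forall fun n => ?_)
      (Eventually.of_forall fun n => ?_) (hW.const_mul R) ?_
    · exact ((contDiff_cutoffRamp R n).continuous.comp
        continuous_norm).aestronglyMeasurable.mul hWm
    · filter_upwards [ae_restrict_mem hS] with x hx
      rw [norm_mul, Real.norm_of_nonneg (sq_nonneg ‖fderiv ℝ u x‖)]
      exact mul_le_mul_of_nonneg_right (abs_cutoffRamp_le hR n (le_of_lt hx)) (sq_nonneg _)
    · filter_upwards [ae_restrict_mem hS] with x hx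
      exact (tendsto_cutoffRamp hR (le_of_lt hx)).mul_const _
  have hlim2 : Tendsto (fun n : ℕ => ∫ x in {x : E3 | 1 < ‖x‖},
      |‖x‖ * deriv (cutoffRamp R n) ‖x‖| * ‖fderiv ℝ u x‖ ^ 2) atTop
      (𝓝 (∫ x in {x : E3 | 1 < ‖x‖}, (if ‖x‖ < R then ‖x‖ else 0) * ‖fderiv ℝ u x‖ ^ 2)) := by
    refine tendsto_integral_filter_of_dominated_convergence
      (fun x => (R + R * (C * 2)) * ‖fderiv ℝ u x‖ ^ 2) (Eventually.of_forall fun n => ?_)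
      ((eventually_gt_atTop 0).mono fun n hn => ?_) (hW.const_mul _) ?_
    · have := (contDiff_cutoffRamp R n).continuous_deriv le_rfl
      exact (by fun_prop : Continuous fun x : E3 =>
        |‖x‖ * deriv (cutoffRamp R n) ‖x‖|).aestronglyMeasurable.mul hWm
    · filter_upwards [ae_restrict_mem hS] with x hx
      rw [norm_mul, Real.norm_of_nonneg (sq_nonneg ‖fderiv ℝ u x‖), Real.norm_eq_abs, abs_abs]
      exact mul_le_mul_of_nonneg_right (abs_mul_deriv_cutoffRamp_le hR hC hn (le_of_lt hx))
        (sq_nonneg _)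
    · filter_upwards [ae_restrict_mem hS] with x hx
      exact (tendsto_abs_mul_deriv_cutoffRamp hx).mul_const _
  have hle := le_of_tendsto_of_tendsto hlim1 hlim2 ((eventually_gt_atTop 0).mono fun n hn =>
    integral_weight_mul_energy_le (a := 1 + 1 / n) (b := 2 * n) (by simpa using hn) hreg hharm hW
      (contDiff_cutoffRamp R n) (fun r h => cutoffRamp_of_le hn h)
      (fun r h => cutoffRamp_of_ge hn h))
  have hI1 : IntegrableOn (fun x : E3 => (min ‖x‖ R - 1) * ‖fderiv ℝ u x‖ ^ 2)
      {x : E3 | 1 < ‖x‖} := by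
    refine hW.bdd_mul (c := R) hmin.aestronglyMeasurable ?_
    filter_upwards [ae_restrict_mem hS] with x hx
    have := le_min (le_of_lt hx) hR
    rw [Real.norm_of_nonneg (by linarith)]
    linarith [min_le_right ‖x‖ R]
  have hI2 : IntegrableOn (fun x : E3 => (if ‖x‖ < R then ‖x‖ else 0) * ‖fderiv ℝ u x‖ ^ 2)
      {x : E3 | 1 < ‖x‖} := by
    refine hW.bdd_mul (c := R) hind.aestronglyMeasurable (ae_of_all _ fun x => ?_)
    split_ifs with h
    · simpa using h.le
    · simpa using one_pos.le.trans hR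
  rw [← setIntegral_indicator hT, ← integral_const_mul, ← sub_nonpos,
    ← integral_sub ((hW.indicator hT).const_mul R) hW]
  rw [← sub_nonpos, ← integral_sub hI1 hI2] at hle
  refine le_of_eq_of_le (setIntegral_congr_fun hS fun x hx => ?_) hle
  by_cases h : ‖x‖ < R
  · simp [Set.indicator, h, not_le.2 h, min_eq_left h.le]
    ring
  · simp [Set.indicator, h, not_lt.1 h]
    ring

/-- **Decay of the Dirichlet energy of harmonic functions in an exterior domain:**
if `u : ℝ³∖B̄₁ → ℝ` is harmonic with `∫_{|x|≥1} |∇u|² < ∞`, then for all `R ≥ 1`,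
`∫_{|x|≥R} |∇u|² ≤ (1/R) ∫_{|x|≥1} |∇u|²`
(equivalently `(1/R)∫_{|x|≥R} |∇u|² ≤ (1/R²) ∫_{|x|≥1} |∇u|²`). -/
theorem harmonic_energy_decay (u : E3 → ℝ)
    (hreg : ContDiffOn ℝ 2 u {x : E3 | 1 < ‖x‖})
    (hharm : ∀ x : E3, 1 < ‖x‖ → lapR u x = 0)
    (hfin : (∫⁻ x in {x : E3 | 1 ≤ ‖x‖}, ENNReal.ofReal (‖fderiv ℝ u x‖ ^ 2)) < ⊤) :
    ∀ R : ℝ, 1 ≤ R →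
      (∫⁻ x in {x : E3 | R ≤ ‖x‖}, ENNReal.ofReal (‖fderiv ℝ u x‖ ^ 2))
        ≤ ENNReal.ofReal (1 / R) *
          ∫⁻ x in {x : E3 | 1 ≤ ‖x‖}, ENNReal.ofReal (‖fderiv ℝ u x‖ ^ 2) := by
  intro R hR
  have hR0 : 0 < R := one_pos.trans_le hR
  have hae : ({x : E3 | 1 < ‖x‖} : Set E3) =ᵐ[volume] {x : E3 | 1 ≤ ‖x‖} := by
    have h0 : ∀ᵐ x : E3, x ∉ sphere (0 : E3) 1 :=
      measure_eq_zero_iff_ae_notMem.1 (Measure.addHaar_sphere volume (0 : E3) 1)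
    filter_upwards [h0] with x hx
    refine propext ⟨le_of_lt, fun h => lt_of_le_of_ne h fun h1 => hx (by simp [← h1])⟩
  have hT : {x : E3 | R ≤ ‖x‖} =ᵐ[volume] ({x : E3 | 1 < ‖x‖} ∩ {x | R ≤ ‖x‖} : Set E3) := by
    refine EventuallyEq.trans (Eq.eventuallyEq ?_) (hae.symm.inter (ae_eq_refl _))
    ext x
    exact ⟨fun h => ⟨hR.trans h, h⟩, fun h => h.2⟩
  have hmeas : Measurable fun x : E3 => ‖fderiv ℝ u x‖ ^ 2 :=
    (measurable_fderiv ℝ u).norm.pow_const 2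
  rw [← setLIntegral_congr hae] at hfin ⊢
  rw [setLIntegral_congr hT]
  have hnn : ∀ μ : Measure E3, 0 ≤ᵐ[μ] fun x : E3 => ‖fderiv ℝ u x‖ ^ 2 := fun μ =>
    ae_of_all _ fun x => sq_nonneg _
  have hW : IntegrableOn (fun x => ‖fderiv ℝ u x‖ ^ 2) {x : E3 | 1 < ‖x‖} :=
    ⟨hmeas.aestronglyMeasurable, (hasFiniteIntegral_iff_ofReal (hnn _)).2 hfin⟩
  rw [← ofReal_integral_eq_lintegral_ofReal hW (hnn _), ← ofReal_integral_eq_lintegral_ofReal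
    (hW.mono_set Set.inter_subset_left) (hnn _), ← ENNReal.ofReal_mul (by positivity)]
  refine ENNReal.ofReal_le_ofReal ?_
  rw [one_div, ← div_eq_inv_mul, le_div_iff₀ hR0, mul_comm]
  exact mul_setIntegral_energy_le hR hreg hharm hW

end
end

section
/- For any α < 2 there exist δ > 0 and R₁ > 1 with the following property: for any n0 ∈ S² and any map n ∈ H¹_loc(ℝ³∖B̄₁; S²) with ∫_{ℝ³∖B̄₁} |n−n0|²/|x|² ≤ C_H ∫_{ℝ³∖B̄₁} |∇n|² < ∞ (C_H a fixed Hardy constant) which is energy minimizing (∫|∇n|² ≤ ∫|∇ñ|² for all S²-valued ñ agreeing with n outside a compact subset of ℝ³∖B̄₁), if ∫_{|x|≥1} |∇n|² ≤ δ², then (1/R₁) ∫_{|x|≥R₁} |∇n|² ≤ (1/R₁^α) ∫_{|x|≥1} |∇n|². -/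
open MeasureTheory Filter Metric Real
open scoped ENNReal NNReal Topology

noncomputable section

/-- The exterior `ℝ³ ∖ B̄₁` of the closed unit ball. -/
def ExtB1 : Set E3 := {x : E3 | 1 < ‖x‖}

/-- `|∇f|²`, the squared Frobenius norm of the gradient of `f`. -/
def gradSq (f : E3 → E3) (x : E3) : ℝ :=
  ∑ i : Fin 3, ‖fderiv ℝ f x (EuclideanSpace.single i (1 : ℝ))‖ ^ 2

/-- The Dirichlet energy `∫_s |∇f|²`, valued in `[0,∞]`. -/
def eEnergy (s : Set E3) (f : E3 → E3) : ℝ≥0∞ :=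
  ∫⁻ x in s, ENNReal.ofReal (gradSq f x)

/-- `f` takes values in the unit sphere `S²` on `s`. -/
def UnitValuedOn (f : E3 → E3) (s : Set E3) : Prop := ∀ x ∈ s, ‖f x‖ = 1

/-- `f` minimizes the Dirichlet energy on `s` among all `S²`-valued maps that agree with `f`
outside a compact subset of `s`. -/
def MinimizingOn (f : E3 → E3) (s : Set E3) : Prop :=
  ∀ g : E3 → E3, UnitValuedOn g s → (∀ x ∈ s, DifferentiableAt ℝ g x) →
    (∃ K : Set E3, IsCompact K ∧ K ⊆ s ∧ ∀ x ∈ s \ K, g x = f x) →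
    eEnergy s f ≤ eEnergy s g

/-- An exterior minimizing harmonic map on `ℝ³ ∖ B̄₁` with far-field value `n0 ∈ S²`. -/
def ExtMinimizer (n0 : E3) (n : E3 → E3) : Prop :=
  UnitValuedOn n ExtB1 ∧ (∀ x ∈ ExtB1, DifferentiableAt ℝ n x) ∧
  (∫⁻ x in ExtB1, (‖n x - n0‖₊ : ℝ≥0∞) ^ 2 / (‖x‖₊ : ℝ≥0∞) ^ 2) < ⊤ ∧
  eEnergy ExtB1 n < ⊤ ∧ MinimizingOn n ExtB1

/-- The squared positive part, a `C¹` function with derivative `2 max x 0`. -/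
lemma hasDerivAt_max_zero_sq (x : ℝ) :
    HasDerivAt (fun y : ℝ => max y 0 ^ 2) (2 * max x 0) x := by
  rcases lt_trichotomy x 0 with h | h | h
  · have : (fun y : ℝ => max y 0 ^ 2) =ᶠ[𝓝 x] fun _ => 0 := by
      filter_upwards [gt_mem_nhds h] with y hy
      simp [max_eq_right hy.le]
    simpa [max_eq_right h.le] using (hasDerivAt_const x (0 : ℝ)).congr_of_eventuallyEq this
  · subst h
    have : (fun y : ℝ => max y 0 ^ 2) =O[𝓝 0] fun y => ‖y - 0‖ ^ 2 := by
      refine Asymptotics.IsBigO.of_bound 1 (Eventually.of_forall fun y => ?_)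
      simp only [norm_pow, Real.norm_eq_abs, sub_zero, one_mul, abs_abs]
      refine pow_le_pow_left₀ (abs_nonneg _) ?_ 2
      rw [abs_of_nonneg (le_max_right y 0)]
      exact max_le (le_abs_self y) (abs_nonneg y)
    simpa using (this.hasFDerivAt one_lt_two).hasDerivAt
  · have : (fun y : ℝ => max y 0 ^ 2) =ᶠ[𝓝 x] fun y => y ^ 2 := by
      filter_upwards [lt_mem_nhds h] with y hy
      simp [max_eq_left hy.le]
    simpa [max_eq_left h.le] using (hasDerivAt_pow 2 x).congr_of_eventuallyEq this

/-- A `C¹` nondecreasing ramp from `0` (for `x ≤ 0`) to `M` (for `x ≥ M + 1`). -/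
def ramp (M x : ℝ) : ℝ :=
  (max x 0 ^ 2 - max (x - 1) 0 ^ 2 - max (x - M) 0 ^ 2 + max (x - M - 1) 0 ^ 2) / 2

/-- The derivative of `ramp`. -/
def rampDeriv (M x : ℝ) : ℝ :=
  max x 0 - max (x - 1) 0 - max (x - M) 0 + max (x - M - 1) 0

lemma hasDerivAt_ramp (M x : ℝ) : HasDerivAt (ramp M) (rampDeriv M x) x := by
  have h (c : ℝ) : HasDerivAt (fun y : ℝ => max (y - c) 0 ^ 2) (2 * max (x - c) 0) x := by
    simpa [Function.comp_def] using
      (hasDerivAt_max_zero_sq (x - c)).comp x ((hasDerivAt_id x).sub_const c)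
  have := ((((h 0).sub (h 1)).sub (h M)).add (h (M + 1))).div_const 2
  convert! this using 1
  · ext y; simp [ramp, sub_sub]
  · simp only [rampDeriv, sub_sub, sub_zero]; ring

lemma continuous_rampDeriv (M : ℝ) : Continuous (rampDeriv M) := by
  unfold rampDeriv; fun_prop

lemma ramp_of_nonpos {M x : ℝ} (hM : 1 ≤ M) (hx : x ≤ 0) : ramp M x = 0 := by
  rw [ramp, max_eq_right hx, max_eq_right (by linarith), max_eq_right (by linarith),
    max_eq_right (by linarith)]
  ring

lemma rampDeriv_of_nonpos {M x : ℝ} (hM : 1 ≤ M) (hx : x ≤ 0) : rampDeriv M x = 0 := by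
  rw [rampDeriv, max_eq_right hx, max_eq_right (by linarith), max_eq_right (by linarith),
    max_eq_right (by linarith)]
  ring

lemma ramp_of_ge {M x : ℝ} (hM : 1 ≤ M) (hx : M + 1 ≤ x) : ramp M x = M := by
  rw [ramp, max_eq_left (by linarith), max_eq_left (by linarith), max_eq_left (by linarith),
    max_eq_left (by linarith)]
  ring

lemma rampDeriv_of_ge {M x : ℝ} (hM : 1 ≤ M) (hx : M + 1 ≤ x) : rampDeriv M x = 0 := by
  rw [rampDeriv, max_eq_left (by linarith), max_eq_left (by linarith), max_eq_left (by linarith),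
    max_eq_left (by linarith)]
  ring

lemma rampDeriv_nonneg {M : ℝ} (hM : 1 ≤ M) (x : ℝ) : 0 ≤ rampDeriv M x := by
  simp only [rampDeriv, max_def]; split_ifs <;> linarith

lemma rampDeriv_le_one {M : ℝ} (hM : 1 ≤ M) (x : ℝ) : rampDeriv M x ≤ 1 := by
  simp only [rampDeriv, max_def]; split_ifs <;> linarith

lemma monotone_ramp {M : ℝ} (hM : 1 ≤ M) : Monotone (ramp M) :=
  monotone_of_hasDerivAt_nonneg (hasDerivAt_ramp M) (rampDeriv_nonneg hM)

lemma ramp_nonneg {M : ℝ} (hM : 1 ≤ M) (x : ℝ) : 0 ≤ ramp M x := by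
  rw [← ramp_of_nonpos hM (min_le_right x 0)]
  exact monotone_ramp hM (min_le_left x 0)

lemma ramp_le {M : ℝ} (hM : 1 ≤ M) (x : ℝ) : ramp M x ≤ M := by
  conv_rhs => rw [← ramp_of_ge hM (le_max_right x (M + 1))]
  exact monotone_ramp hM (le_max_left x _)

lemma mul_rampDeriv_sub_ramp_le {M : ℝ} (hM : 1 ≤ M) (x : ℝ) :
    (x + 2) * rampDeriv M x - ramp M x ≤ 4 := by
  simp only [rampDeriv, ramp, max_def]; split_ifs <;> nlinarith

/-- A radial profile, equal to `1` on `[M + 3, L]` and vanishing near the unit ball and near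
infinity, which grows almost linearly on `[1, M + 3]`. -/
lemma exists_profile {M L : ℝ} (hM : 3 ≤ M) (hL : M + 3 ≤ L) :
    ∃ h h' : ℝ → ℝ, (∀ r, HasDerivAt h (h' r) r) ∧ Continuous h' ∧
      (∀ r ≤ 2, h r = 0) ∧ (∀ r, 3 * L ≤ r → h r = 0) ∧ (∀ r, 0 ≤ h r ∧ h r ≤ 1) ∧
      (∀ r, 0 < r → |r * h' r| ≤ 3) ∧
      (∀ r ≤ M + 3, 0 ≤ h' r ∧ r * h' r - h r ≤ 4 / M) ∧
      (∀ r, M + 3 ≤ r → r ≤ L → h r = 1 ∧ h' r = 0) := by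
  have hM1 : 1 ≤ M := by linarith
  have hM0 : 0 < M := by linarith
  have hL0 : 0 < L := by linarith
  have out_lt {r : ℝ} (hr : r ≤ L) : (r - L) / L ≤ 0 :=
    div_nonpos_of_nonpos_of_nonneg (by linarith) hL0.le
  have out_ge {r : ℝ} (hr : 3 * L ≤ r) : 1 + 1 ≤ (r - L) / L := by
    rw [le_div_iff₀ hL0]; linarith
  refine ⟨fun r => ramp M (r - 2) / M - ramp 1 ((r - L) / L),
    fun r => rampDeriv M (r - 2) / M - rampDeriv 1 ((r - L) / L) / L,
    fun r => ?_, ?_, fun r hr => ?_, fun r hr => ?_, fun r => ?_, fun r hr => ?_,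
    fun r hr => ?_, fun r hr hr' => ?_⟩
  · refine HasDerivAt.sub ?_ ?_
    · simpa [Function.comp_def] using ((hasDerivAt_ramp M (r - 2)).comp r
        ((hasDerivAt_id r).sub_const 2)).div_const M
    · simpa [div_eq_mul_inv, Function.comp_def] using (hasDerivAt_ramp 1 ((r - L) / L)).comp r
        (((hasDerivAt_id r).sub_const L).div_const L)
  · have := continuous_rampDeriv M
    have := continuous_rampDeriv 1
    fun_prop
  all_goals beta_reduce
  · rw [ramp_of_nonpos hM1 (by linarith), ramp_of_nonpos le_rfl (out_lt (by linarith))]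
    simp
  · rw [ramp_of_ge hM1 (by linarith), ramp_of_ge le_rfl (out_ge hr), div_self hM0.ne', sub_self]
  · rcases le_total r L with hr | hr
    · rw [ramp_of_nonpos le_rfl (out_lt hr), sub_zero]
      exact ⟨div_nonneg (ramp_nonneg hM1 _) hM0.le, (div_le_one hM0).2 (ramp_le hM1 _)⟩
    · rw [ramp_of_ge hM1 (by linarith), div_self hM0.ne']
      have := ramp_nonneg le_rfl ((r - L) / L)
      have := ramp_le le_rfl ((r - L) / L)
      constructor <;> linarith
  · rcases le_total r L with hrL | hrL
    · rw [rampDeriv_of_nonpos le_rfl (out_lt hrL), zero_div, sub_zero]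
      rcases le_total r (M + 3) with hrM | hrM
      · have h0 := rampDeriv_nonneg hM1 (r - 2)
        have h1 := rampDeriv_le_one hM1 (r - 2)
        rw [abs_of_nonneg (by positivity), ← mul_div_assoc, div_le_iff₀ hM0]
        nlinarith
      · rw [rampDeriv_of_ge hM1 (by linarith)]; simp
    · rw [rampDeriv_of_ge hM1 (by linarith), zero_div, zero_sub, mul_neg, abs_neg]
      rcases le_total r (3 * L) with hr3 | hr3
      · have h0 := rampDeriv_nonneg le_rfl ((r - L) / L)
        have h1 := rampDeriv_le_one le_rfl ((r - L) / L)
        rw [abs_of_nonneg (by positivity), ← mul_div_assoc, div_le_iff₀ hL0]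
        nlinarith
      · rw [rampDeriv_of_ge le_rfl (out_ge hr3)]; simp
  · rw [ramp_of_nonpos le_rfl (out_lt (by linarith)),
      rampDeriv_of_nonpos le_rfl (out_lt (by linarith)), zero_div, sub_zero, sub_zero]
    refine ⟨div_nonneg (rampDeriv_nonneg hM1 _) hM0.le, ?_⟩
    rw [← mul_div_assoc, ← sub_div]
    have := mul_rampDeriv_sub_ramp_le hM1 (r - 2)
    rw [sub_add_cancel] at this
    gcongr
  · rw [ramp_of_ge hM1 (by linarith), rampDeriv_of_ge hM1 (by linarith),
      ramp_of_nonpos le_rfl (out_lt hr'), rampDeriv_of_nonpos le_rfl (out_lt hr'), div_self hM0.ne']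
    simp

/-- The differential at `y` of the radial map `x ↦ f(|x|) x`, where `w` and `w'` are the values at
`|y|` of `f` and of its derivative. -/
def radialFDeriv (w w' : ℝ) (y : E3) : E3 →L[ℝ] E3 :=
  w • ContinuousLinearMap.id ℝ E3 + (w' / ‖y‖) • (innerSL ℝ y).smulRight y

lemma radialFDeriv_apply (w w' : ℝ) (y v : E3) :
    radialFDeriv w w' y v = w • v + (w' / ‖y‖ * inner ℝ y v) • y := by
  simp [radialFDeriv, mul_smul]

lemma hasStrictFDerivAt_radial {w w' : ℝ → ℝ} (hw : ∀ r, HasDerivAt w (w' r) r)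
    (hw' : Continuous w') {y : E3} (hy : y ≠ 0) :
    HasStrictFDerivAt (fun x : E3 => w ‖x‖ • x) (radialFDeriv (w ‖y‖) (w' ‖y‖) y) y := by
  have hy0 : ‖y‖ ≠ 0 := norm_ne_zero_iff.2 hy
  have h1 : HasStrictFDerivAt (fun x : E3 => ‖x‖) (‖y‖⁻¹ • innerSL ℝ y) y := by
    have := (hasStrictFDerivAt_norm_sq y).sqrt (pow_ne_zero 2 hy0)
    simp only [Real.sqrt_sq (norm_nonneg _)] at this
    convert! this using 1
    ext v
    simp
    field_simp
  have h2 := (hasStrictDerivAt_of_hasDerivAt_of_continuousAt (Eventually.of_forall hw)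
    hw'.continuousAt).comp_hasStrictFDerivAt y h1
  convert! h2.smul (hasStrictFDerivAt_id y) using 1
  ext v
  simp [radialFDeriv, div_eq_mul_inv, smul_smul, mul_assoc]

lemma norm_sq_E3 (y : E3) : ‖y‖ ^ 2 = y 0 ^ 2 + y 1 ^ 2 + y 2 ^ 2 := by
  rw [EuclideanSpace.norm_sq_eq, Fin.sum_univ_three]
  simp

lemma det_radialFDeriv (w w' : ℝ) {y : E3} (hy : y ≠ 0) :
    (radialFDeriv w w' y).det = w ^ 2 * (w + ‖y‖ * w') := by
  have hy0 : ‖y‖ ≠ 0 := norm_ne_zero_iff.2 hy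
  rw [ContinuousLinearMap.det, ← LinearMap.det_toMatrix (EuclideanSpace.basisFun (Fin 3) ℝ).toBasis,
    Matrix.det_fin_three]
  simp [LinearMap.toMatrix_apply, radialFDeriv_apply, EuclideanSpace.inner_single_right]
  have : ‖y‖ * w' = w' / ‖y‖ * ‖y‖ ^ 2 := by field_simp
  rw [this, norm_sq_E3]
  ring

/-- `radialFDeriv` as an equivalence, with the explicit inverse. -/
def radialFDerivEquiv (w w' : ℝ) (y : E3) (hy : y ≠ 0) (hw : w ≠ 0) (hp : w + ‖y‖ * w' ≠ 0) :
    E3 ≃L[ℝ] E3 :=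
  ContinuousLinearEquiv.equivOfInverse (radialFDeriv w w' y)
    (radialFDeriv w⁻¹ (-(w' / (w * (w + ‖y‖ * w')))) y)
    (fun v => by
      have hy0 : ‖y‖ ≠ 0 := norm_ne_zero_iff.2 hy
      have hp' : w + w' * ‖y‖ ≠ 0 := by rwa [mul_comm w']
      simp only [radialFDeriv_apply, inner_add_right, inner_smul_right, real_inner_self_eq_norm_sq]
      match_scalars <;> field_simp
      ring)
    (fun v => by
      have hy0 : ‖y‖ ≠ 0 := norm_ne_zero_iff.2 hy
      have hp' : w + w' * ‖y‖ ≠ 0 := by rwa [mul_comm w']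
      simp only [radialFDeriv_apply, inner_add_right, inner_smul_right, real_inner_self_eq_norm_sq]
      match_scalars <;> field_simp
      ring)

/-- The squared Frobenius norm of a linear map. -/
def frobSq (T : E3 →L[ℝ] E3) : ℝ :=
  ∑ i : Fin 3, ‖T (EuclideanSpace.single i (1 : ℝ))‖ ^ 2

lemma map_eq_sum (T : E3 →L[ℝ] E3) (y : E3) :
    T y = ∑ i : Fin 3, y i • T (EuclideanSpace.single i (1 : ℝ)) := by
  conv_lhs => rw [← (EuclideanSpace.basisFun (Fin 3) ℝ).sum_repr y]
  simp [map_sum]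

lemma norm_map_sq_le (T : E3 →L[ℝ] E3) (y : E3) : ‖T y‖ ^ 2 ≤ ‖y‖ ^ 2 * frobSq T := by
  rw [map_eq_sum T y, frobSq]
  calc _ ≤ (∑ i : Fin 3, ‖y i‖ * ‖T (EuclideanSpace.single i (1 : ℝ))‖) ^ 2 := by
        refine pow_le_pow_left₀ (norm_nonneg _) ?_ 2
        simpa only [norm_smul] using norm_sum_le Finset.univ
          fun i => y i • T (EuclideanSpace.single i (1 : ℝ))
    _ ≤ _ := by
        rw [EuclideanSpace.norm_sq_eq]
        exact Finset.sum_mul_sq_le_sq_mul_sq _ _ _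

lemma frobSq_comp_radialFDeriv (T : E3 →L[ℝ] E3) (w w' : ℝ) {y : E3} (hy : y ≠ 0) :
    frobSq (T ∘L radialFDeriv w w' y) =
      w ^ 2 * (frobSq T - ‖T y‖ ^ 2 / ‖y‖ ^ 2) + (w + ‖y‖ * w') ^ 2 * (‖T y‖ ^ 2 / ‖y‖ ^ 2) := by
  have hy0 : ‖y‖ ≠ 0 := norm_ne_zero_iff.2 hy
  set b := w' / ‖y‖ with hb
  have h1 : frobSq (T ∘L radialFDeriv w w' y) =
      w ^ 2 * frobSq T + 2 * w * b * inner ℝ (T y) (T y) + b ^ 2 * ‖y‖ ^ 2 * ‖T y‖ ^ 2 := by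
    have h2 : inner ℝ (T y) (T y) =
        ∑ i : Fin 3, y i * inner ℝ (T (EuclideanSpace.single i (1 : ℝ))) (T y) := by
      conv_lhs => enter [2]; rw [map_eq_sum T y]
      simp [sum_inner, inner_smul_left]
    rw [h2, norm_sq_E3 y, frobSq, frobSq]
    simp only [Fin.sum_univ_three, ContinuousLinearMap.comp_apply, radialFDeriv_apply, map_add,
      map_smul, EuclideanSpace.inner_single_right, norm_add_sq_real, norm_smul, inner_smul_left,
      inner_smul_right, mul_pow, Real.norm_eq_abs, sq_abs, ← hb]
    simp
    ring
  rw [h1, real_inner_self_eq_norm_sq, hb]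
  field_simp
  ring

lemma frobSq_comp_symm_mul_le (T : E3 →L[ℝ] E3) (w w' : ℝ) {y : E3} (hy : y ≠ 0) (hw : 0 < w)
    (hp : 0 < w + ‖y‖ * w') {c : ℝ} (hc : w + ‖y‖ * w' ≤ c) (hc' : w ^ 2 ≤ c * (w + ‖y‖ * w')) :
    |(radialFDeriv w w' y).det| *
      frobSq (T ∘L (radialFDerivEquiv w w' y hy hw.ne' hp.ne').symm) ≤ c * frobSq T := by
  have hy0 : ‖y‖ ≠ 0 := norm_ne_zero_iff.2 hy
  have hsymm : ((radialFDerivEquiv w w' y hy hw.ne' hp.ne').symm : E3 →L[ℝ] E3) =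
      radialFDeriv w⁻¹ (-(w' / (w * (w + ‖y‖ * w')))) y := rfl
  have hinv : w⁻¹ + ‖y‖ * -(w' / (w * (w + ‖y‖ * w'))) = (w + ‖y‖ * w')⁻¹ := by
    field_simp; ring
  rw [hsymm, frobSq_comp_radialFDeriv _ _ _ hy, hinv, det_radialFDeriv _ _ hy]
  have hle : ‖T y‖ ^ 2 / ‖y‖ ^ 2 ≤ frobSq T :=
    div_le_of_le_mul₀ (by positivity) (Finset.sum_nonneg fun i _ => by positivity)
      ((norm_map_sq_le T y).trans_eq (mul_comm _ _))
  have h0 : 0 ≤ ‖T y‖ ^ 2 / ‖y‖ ^ 2 := by positivity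
  generalize ‖T y‖ ^ 2 / ‖y‖ ^ 2 = B at *
  clear hsymm hinv
  generalize w + ‖y‖ * w' = p at *
  rw [abs_of_pos (by positivity)]
  have h2 : w ^ 2 / p ≤ c := by rwa [div_le_iff₀ hp]
  calc w ^ 2 * p * (w⁻¹ ^ 2 * (frobSq T - B) + p⁻¹ ^ 2 * B)
      = p * (frobSq T - B) + w ^ 2 / p * B := by field_simp
    _ ≤ c * (frobSq T - B) + c * B := by
        gcongr
    _ = c * frobSq T := by ring

lemma gradSq_eq_frobSq (f : E3 → E3) (x : E3) : gradSq f x = frobSq (fderiv ℝ f x) := rfl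

lemma isOpen_ExtB1 : IsOpen ExtB1 := isOpen_lt continuous_const continuous_norm

lemma strictMonoOn_radius_mul {w w' : ℝ → ℝ} (hw : ∀ r, HasDerivAt w (w' r) r)
    (hp : ∀ r, 0 < r → 0 < w r + r * w' r) : StrictMonoOn (fun r => r * w r) (Set.Ici 1) := by
  have hd (r : ℝ) : HasDerivAt (fun r => r * w r) (w r + r * w' r) r := by
    convert! (hasDerivAt_id r).mul (hw r) using 1
    simp
  refine strictMonoOn_of_deriv_pos (convex_Ici 1)
    (fun r _ => (hd r).continuousAt.continuousWithinAt) fun r hr => ?_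
  rw [interior_Ici] at hr
  rw [(hd r).deriv]
  exact hp r (one_pos.trans hr)

/-- A radial stretching `x ↦ w(|x|) x` which is the identity near the unit ball and near infinity
is a bijection of the exterior domain. -/
lemma bijOn_radial {w w' : ℝ → ℝ} (hw : ∀ r, HasDerivAt w (w' r) r)
    (hpos : ∀ r, 0 < w r) (hp : ∀ r, 0 < r → 0 < w r + r * w' r) {b : ℝ}
    (hw1 : w 1 = 1) (hwb : ∀ r, b ≤ r → w r = 1) :
    Set.BijOn (fun y : E3 => w ‖y‖ • y) ExtB1 ExtB1 := by
  have hmono := strictMonoOn_radius_mul hw hp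
  have hnorm (y : E3) : ‖w ‖y‖ • y‖ = ‖y‖ * w ‖y‖ := by
    rw [norm_smul, Real.norm_of_nonneg (hpos _).le, mul_comm]
  refine ⟨fun y hy => ?_, fun y hy z hz hyz => ?_, fun x hx => ?_⟩
  · have hy' : 1 < ‖y‖ := hy
    have := hmono (Set.mem_Ici.2 le_rfl) (Set.mem_Ici.2 hy'.le) hy'
    simpa [ExtB1, hnorm, hw1] using this
  · have hyz' := congrArg norm hyz
    simp only [hnorm] at hyz'
    have h : ‖y‖ = ‖z‖ := hmono.injOn (Set.mem_Ici.2 (le_of_lt hy)) (Set.mem_Ici.2 (le_of_lt hz)) hyz'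
    simp only [h] at hyz
    exact smul_right_injective E3 (hpos ‖z‖).ne' hyz
  · have hx' : 1 < ‖x‖ := hx
    have hcont : Continuous fun r => r * w r :=
      continuous_id.mul (continuous_iff_continuousAt.2 fun r => (hw r).continuousAt)
    have hmem : ‖x‖ ∈ Set.Icc (1 * w 1) (max b ‖x‖ * w (max b ‖x‖)) := by
      rw [hw1, hwb _ (le_max_left _ _), mul_one, mul_one]
      exact ⟨hx'.le, le_max_right _ _⟩
    obtain ⟨r, hr, hrx⟩ := intermediate_value_Icc (hx'.le.trans (le_max_right b ‖x‖))
      hcont.continuousOn hmem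
    simp only at hrx
    have hr1 : 1 < r := by
      refine lt_of_le_of_ne hr.1 fun h => ?_
      rw [← h, hw1, mul_one] at hrx
      exact hx'.ne hrx
    have hx0 : ‖x‖ ≠ 0 := by positivity
    have hn : ‖(r / ‖x‖) • x‖ = r := by
      rw [norm_smul, Real.norm_of_nonneg (by positivity), div_mul_cancel₀ _ hx0]
    refine ⟨(r / ‖x‖) • x, by rw [ExtB1, Set.mem_ofPred_eq, hn]; exact hr1, ?_⟩
    simp only [hn]
    rw [smul_smul, mul_div_assoc', mul_comm, hrx, div_self hx0, one_smul]

/-- Comparison of a minimizing map with its composition with a radial stretching. -/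
lemma eEnergy_le_of_radial {n : E3 → E3} (hunit : UnitValuedOn n ExtB1)
    (hdiff : ∀ x ∈ ExtB1, DifferentiableAt ℝ n x) (hmin : MinimizingOn n ExtB1)
    {w w' c : ℝ → ℝ} (hw : ∀ r, HasDerivAt w (w' r) r) (hw' : Continuous w')
    (hpos : ∀ r, 0 < w r) (hp : ∀ r, 0 < r → 0 < w r + r * w' r) {a b : ℝ} (ha : 1 < a)
    (hwa : ∀ r ≤ a, w r = 1) (hwb : ∀ r, b ≤ r → w r = 1)
    (hc : ∀ r, 1 < r → w r + r * w' r ≤ c r)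
    (hc' : ∀ r, 1 < r → w r ^ 2 ≤ c r * (w r + r * w' r)) :
    eEnergy ExtB1 n ≤
      ∫⁻ y in ExtB1, ENNReal.ofReal (c ‖y‖) * ENNReal.ofReal (gradSq n y) := by
  set Ψ : E3 → E3 := fun y => w ‖y‖ • y with hΨ
  have hbij : Set.BijOn Ψ ExtB1 ExtB1 := bijOn_radial hw hpos hp (hwa 1 ha.le) hwb
  set Φ : E3 → E3 := Function.invFunOn Ψ ExtB1
  have hleft : ∀ y ∈ ExtB1, Φ (Ψ y) = y := fun y hy => hbij.injOn.leftInvOn_invFunOn hy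
  have hne {y : E3} (hy : y ∈ ExtB1) : y ≠ 0 := norm_pos_iff.1 (one_pos.trans hy)
  have hΨ' (y : E3) (hy : y ∈ ExtB1) :
      HasStrictFDerivAt Ψ (radialFDeriv (w ‖y‖) (w' ‖y‖) y) y :=
    hasStrictFDerivAt_radial hw hw' (hne hy)
  have hΦ' (y : E3) (hy : y ∈ ExtB1) :
      HasFDerivAt Φ ((radialFDerivEquiv (w ‖y‖) (w' ‖y‖) y (hne hy) (hpos _).ne'
        (hp _ (norm_pos_iff.2 (hne hy))).ne').symm : E3 →L[ℝ] E3) (Ψ y) := by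
    have hs : HasStrictFDerivAt Ψ (radialFDerivEquiv (w ‖y‖) (w' ‖y‖) y (hne hy) (hpos _).ne'
        (hp _ (norm_pos_iff.2 (hne hy))).ne' : E3 →L[ℝ] E3) y := hΨ' y hy
    refine (hs.to_local_left_inverse ?_).hasFDerivAt
    filter_upwards [isOpen_ExtB1.mem_nhds hy] with z hz using hleft z hz
  have hcomp (y : E3) (hy : y ∈ ExtB1) : HasFDerivAt (n ∘ Φ) (fderiv ℝ n y ∘L
      ((radialFDerivEquiv (w ‖y‖) (w' ‖y‖) y (hne hy) (hpos _).ne'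
        (hp _ (norm_pos_iff.2 (hne hy))).ne').symm : E3 →L[ℝ] E3)) (Ψ y) := by
    refine HasFDerivAt.comp (Ψ y) ?_ (hΦ' y hy)
    rw [hleft y hy]
    exact (hdiff y hy).hasFDerivAt
  have hle : eEnergy ExtB1 n ≤ eEnergy ExtB1 (n ∘ Φ) := by
    refine hmin _ ?_ ?_ ⟨{x | a ≤ ‖x‖ ∧ ‖x‖ ≤ b}, ?_, fun x hx => ha.trans_le hx.1, ?_⟩
    · intro x hx
      obtain ⟨y, hy, rfl⟩ := hbij.surjOn hx
      rw [Function.comp_apply, hleft y hy]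
      exact hunit y hy
    · intro x hx
      obtain ⟨y, hy, rfl⟩ := hbij.surjOn hx
      exact (hcomp y hy).differentiableAt
    · refine (isCompact_closedBall (0 : E3) b).of_isClosed_subset
        ((isClosed_le continuous_const continuous_norm).inter
          (isClosed_le continuous_norm continuous_const)) fun x hx => ?_
      simpa using hx.2
    · rintro x ⟨hx, hxK⟩
      have hfix : Ψ x = x := by
        have : w ‖x‖ = 1 := by
          rcases le_or_gt ‖x‖ a with h | h
          · exact hwa _ h
          · refine hwb _ (le_of_not_ge fun h' => hxK ⟨h.le, h'⟩)
        simp [hΨ, this]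
      rw [Function.comp_apply]
      conv_lhs => rw [← hfix]
      rw [hleft x hx]
  refine hle.trans ?_
  rw [eEnergy]
  conv_lhs => rw [← hbij.image_eq]
  rw [lintegral_image_eq_lintegral_abs_det_fderiv_mul volume isOpen_ExtB1.measurableSet
    (fun y hy => (hΨ' y hy).hasFDerivAt.hasFDerivWithinAt) hbij.injOn]
  refine setLIntegral_mono' isOpen_ExtB1.measurableSet fun y hy => ?_
  have hy1 : 1 < ‖y‖ := hy
  have hp1 := hp ‖y‖ (one_pos.trans hy1)
  rw [gradSq_eq_frobSq, gradSq_eq_frobSq, (hcomp y hy).fderiv,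
    ← ENNReal.ofReal_mul (abs_nonneg _),
    ← ENNReal.ofReal_mul (hp1.le.trans (hc _ hy1))]
  exact ENNReal.ofReal_le_ofReal
    (frobSq_comp_symm_mul_le _ _ _ (hne hy) (hpos _) hp1 (hc _ hy1) (hc' _ hy1))

/-- Splitting the comparison into an inner annulus, an outer annulus and a neighbourhood of
infinity. -/
lemma eEnergy_le_add_annulus_add_tail {n : E3 → E3} (hunit : UnitValuedOn n ExtB1)
    (hdiff : ∀ x ∈ ExtB1, DifferentiableAt ℝ n x) (hmin : MinimizingOn n ExtB1)
    {M L : ℝ} (hM : 8 ≤ M) (hL : M + 3 ≤ L) :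
    eEnergy ExtB1 n ≤
      ENNReal.ofReal (1 + 10 / M ^ 2) * eEnergy {x | 1 < ‖x‖ ∧ ‖x‖ < M + 3} n +
      (ENNReal.ofReal (1 - 1 / M) * eEnergy {x | M + 3 ≤ ‖x‖ ∧ ‖x‖ < L} n +
      ENNReal.ofReal 2 * eEnergy {x | L ≤ ‖x‖} n) := by
  obtain ⟨h, h', hh, hh', h2, h3L, h01, h3, hin, hmid⟩ :=
    exists_profile (M := M) (L := L) (by linarith) hL
  have hM0 : 0 < M := by linarith
  obtain ⟨t, ht⟩ : ∃ t, t = 1 / M := ⟨_, rfl⟩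
  have ht0 : 0 < t := by rw [ht]; positivity
  have ht8 : t ≤ 1 / 8 := by rw [ht]; gcongr
  have hth (r : ℝ) : 0 ≤ t * h r ∧ t * h r ≤ 1 / 8 :=
    ⟨mul_nonneg ht0.le (h01 r).1, by nlinarith [h01 r]⟩
  have htd {r : ℝ} (hr : 0 < r) : -(3 / 8) ≤ t * (r * h' r) ∧ t * (r * h' r) ≤ 3 / 8 := by
    have := abs_le.1 (h3 r hr)
    constructor <;> nlinarith
  have hsq : 10 / M ^ 2 = 10 * t ^ 2 := by rw [ht]; field_simp
  have h4 : 4 / M = 4 * t := by rw [ht]; field_simp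
  rw [hsq, ← ht]
  have key := eEnergy_le_of_radial hunit hdiff hmin (b := 3 * L) (w := fun r => 1 - t * h r)
    (w' := fun r => -(t * h' r))
    (c := fun r => if r < M + 3 then 1 + 10 * t ^ 2 else if r < L then 1 - t else 2)
    (fun r => by simpa using ((hh r).const_mul t).const_sub 1) (by fun_prop)
    (fun r => by linarith [hth r]) (fun r hr => by linarith [hth r, htd hr]) one_lt_two
    (fun r hr => by simp [h2 r hr]) (fun r hr => by simp [h3L r hr])
    (fun r hr => ?_) (fun r hr => ?_)
  · have hmI : MeasurableSet {x : E3 | 1 < ‖x‖ ∧ ‖x‖ < M + 3} :=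
      (measurableSet_lt measurable_const measurable_norm).inter
        (measurableSet_lt measurable_norm measurable_const)
    have hmM : MeasurableSet {x : E3 | M + 3 ≤ ‖x‖ ∧ ‖x‖ < L} :=
      (measurableSet_le measurable_const measurable_norm).inter
        (measurableSet_lt measurable_norm measurable_const)
    have hmO : MeasurableSet {x : E3 | L ≤ ‖x‖} :=
      measurableSet_le measurable_const measurable_norm
    have hsub : ExtB1 ⊆ {x : E3 | 1 < ‖x‖ ∧ ‖x‖ < M + 3} ∪
        ({x : E3 | M + 3 ≤ ‖x‖ ∧ ‖x‖ < L} ∪ {x : E3 | L ≤ ‖x‖}) := by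
      intro x hx
      rcases lt_or_ge ‖x‖ (M + 3) with h | h
      · exact Or.inl ⟨hx, h⟩
      · rcases lt_or_ge ‖x‖ L with h'' | h''
        · exact Or.inr (Or.inl ⟨h, h''⟩)
        · exact Or.inr (Or.inr h'')
    refine key.trans <| (lintegral_mono_set hsub).trans <| (lintegral_union_le _ _ _).trans <|
      add_le_add ?_ ((lintegral_union_le _ _ _).trans (add_le_add ?_ ?_))
    all_goals rw [eEnergy, ← lintegral_const_mul' _ _ ENNReal.ofReal_ne_top]
    · refine setLIntegral_mono' hmI fun x hx => ?_
      rw [if_pos hx.2]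
    · refine setLIntegral_mono' hmM fun x hx => ?_
      rw [if_neg hx.1.not_gt, if_pos hx.2]
    · refine setLIntegral_mono' hmO fun x hx => ?_
      have hx' : L ≤ ‖x‖ := hx
      rw [if_neg (hL.trans hx').not_gt, if_neg hx'.not_gt]
  · have hr0 : 0 < r := by linarith
    have := hth r
    have := htd hr0
    split_ifs with hr1 hr2
    · have := mul_nonneg ht0.le (mul_nonneg hr0.le (hin r hr1.le).1)
      nlinarith
    · obtain ⟨e, e'⟩ := hmid r (not_lt.1 hr1) hr2.le
      simp [e, e']
    · linarith
  · have hr0 : 0 < r := by linarith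
    have h1 := hth r
    have h2 := htd hr0
    split_ifs with hr1 hr2
    · have h5 := (hin r hr1.le).2
      rw [h4] at h5
      nlinarith [mul_le_mul_of_nonneg_left h5 ht0.le, h01 r,
        mul_le_mul_of_nonneg_left (show h r ^ 2 ≤ 1 by nlinarith [h01 r]) (sq_nonneg t),
        mul_le_mul_of_nonneg_left (show (1 / 2 : ℝ) ≤ 1 - t * h r - t * (r * h' r) by linarith)
          (sq_nonneg t)]
    · obtain ⟨e, e'⟩ := hmid r (not_lt.1 hr1) hr2.le
      simp only [e, e']
      nlinarith
    · nlinarith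

lemma tendsto_eEnergy_tail {n : E3 → E3} (hfin : eEnergy ExtB1 n < ⊤) :
    Tendsto (fun k : ℕ => eEnergy {x | (k : ℝ) ≤ ‖x‖} n) atTop (𝓝 0) := by
  set ν := (volume : Measure E3).withDensity fun x => ENNReal.ofReal (gradSq n x) with hν
  have hm (k : ℕ) : MeasurableSet {x : E3 | (k : ℝ) ≤ ‖x‖} :=
    measurableSet_le measurable_const measurable_norm
  have hE (k : ℕ) : eEnergy {x | (k : ℝ) ≤ ‖x‖} n = ν {x | (k : ℝ) ≤ ‖x‖} := by
    rw [hν, withDensity_apply _ (hm k), eEnergy]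
  simp only [hE]
  have hempty : ⋂ k : ℕ, {x : E3 | (k : ℝ) ≤ ‖x‖} = ∅ := by
    refine Set.eq_empty_of_forall_notMem fun x hx => ?_
    obtain ⟨k, hk⟩ := exists_nat_gt ‖x‖
    exact hk.not_ge (Set.mem_iInter.1 hx k)
  rw [← measure_empty (μ := ν), ← hempty]
  refine tendsto_measure_iInter_atTop (fun k => (hm k).nullMeasurableSet)
    (fun i j hij x hx => le_trans (Nat.cast_le.2 hij : (i : ℝ) ≤ j) hx) ⟨2, ?_⟩
  rw [← hE]
  refine ((lintegral_mono_set fun x hx => ?_).trans_lt hfin).ne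
  have : (2 : ℝ) ≤ ‖x‖ := by exact_mod_cast hx
  exact one_lt_two.trans_le this

/-- Minimizing maps of finite energy decay like `1 / R`, with no smallness assumption. -/
lemma eEnergy_exterior_le {n : E3 → E3} (hunit : UnitValuedOn n ExtB1)
    (hdiff : ∀ x ∈ ExtB1, DifferentiableAt ℝ n x) (hfin : eEnergy ExtB1 n < ⊤)
    (hmin : MinimizingOn n ExtB1) {M : ℝ} (hM : 8 ≤ M) :
    eEnergy {x | M + 3 ≤ ‖x‖} n ≤ ENNReal.ofReal (10 / M) * eEnergy ExtB1 n := by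
  have hM0 : 0 < M := by linarith
  have hsubfin {s : Set E3} (hs : s ⊆ ExtB1) : eEnergy s n ≠ ⊤ :=
    ((lintegral_mono_set hs).trans_lt hfin).ne
  set A := eEnergy {x | 1 < ‖x‖ ∧ ‖x‖ < M + 3} n with hA
  set X := eEnergy {x | M + 3 ≤ ‖x‖} n with hX
  have hAfin : A ≠ ⊤ := hsubfin fun x hx => hx.1
  have hXfin : X ≠ ⊤ := hsubfin fun x (hx : M + 3 ≤ ‖x‖) => by
    show 1 < ‖x‖
    linarith
  have hAX : eEnergy ExtB1 n = A + X := by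
    rw [hA, hX, eEnergy, eEnergy, eEnergy, ← lintegral_union
      (measurableSet_le measurable_const measurable_norm)
      (Set.disjoint_left.2 fun x hx hx' => hx.2.not_ge hx')]
    congr 2
    ext x
    simp only [ExtB1, Set.mem_ofPred_eq, Set.mem_union]
    constructor
    · intro hx
      rcases lt_or_ge ‖x‖ (M + 3) with h | h
      exacts [Or.inl ⟨hx, h⟩, Or.inr h]
    · rintro (hx | hx)
      exacts [hx.1, by linarith]
  have hbound {k : ℕ} (hk : M + 3 ≤ k) :
      X.toReal ≤ 10 / M * A.toReal + 2 * M * (eEnergy {x | (k : ℝ) ≤ ‖x‖} n).toReal := by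
    set D := eEnergy {x | (k : ℝ) ≤ ‖x‖} n with hD
    set B := eEnergy {x | M + 3 ≤ ‖x‖ ∧ ‖x‖ < k} n with hB
    have hXBD : X = B + D := by
      rw [hX, hB, hD, eEnergy, eEnergy, eEnergy, ← lintegral_union
        (measurableSet_le measurable_const measurable_norm)
        (Set.disjoint_left.2 fun x hx hx' => hx.2.not_ge hx')]
      congr 2
      ext x
      simp only [Set.mem_ofPred_eq, Set.mem_union]
      constructor
      · intro hx
        rcases lt_or_ge ‖x‖ k with h | h
        exacts [Or.inl ⟨hx, h⟩, Or.inr h]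
      · rintro (hx | hx)
        exacts [hx.1, hk.trans hx]
    have hBfin : B ≠ ⊤ := fun h => hXfin (by rw [hXBD, h, top_add])
    have hDfin : D ≠ ⊤ := fun h => hXfin (by rw [hXBD, h, add_top])
    have key := eEnergy_le_add_annulus_add_tail hunit hdiff hmin hM hk
    rw [hAX, ← hA, ← hB, ← hD, hXBD] at key
    rw [hXBD, ENNReal.toReal_add hBfin hDfin]
    rw [← ENNReal.ofReal_toReal hAfin, ← ENNReal.ofReal_toReal hBfin,
      ← ENNReal.ofReal_toReal hDfin] at key
    have ha := A.toReal_nonneg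
    have hb := B.toReal_nonneg
    have hd := D.toReal_nonneg
    generalize A.toReal = A' at *
    generalize B.toReal = B' at *
    generalize D.toReal = D' at *
    have hM1 : 0 ≤ 1 - 1 / M := by
      rw [sub_nonneg, div_le_one hM0]; linarith
    rw [← ENNReal.ofReal_mul (by positivity), ← ENNReal.ofReal_mul hM1,
      ← ENNReal.ofReal_mul (by positivity), ← ENNReal.ofReal_add hb hd,
      ← ENNReal.ofReal_add ha (by positivity), ← ENNReal.ofReal_add (by positivity) (by positivity),
      ← ENNReal.ofReal_add (by positivity) (by positivity),
      ENNReal.ofReal_le_ofReal_iff (by positivity)] at key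
    have key' : B' / M ≤ 10 / M ^ 2 * A' + D' := by
      rw [div_eq_mul_one_div]
      linarith
    have := mul_le_mul_of_nonneg_left key' hM0.le
    have e1 : M * (B' / M) = B' := by field_simp
    have e2 : M * (10 / M ^ 2 * A' + D') = 10 / M * A' + M * D' := by field_simp
    nlinarith
  have hlim : Tendsto (fun k : ℕ => 10 / M * A.toReal +
      2 * M * (eEnergy {x | (k : ℝ) ≤ ‖x‖} n).toReal) atTop (𝓝 (10 / M * A.toReal)) := by
    have := (ENNReal.tendsto_toReal ENNReal.zero_ne_top).comp (tendsto_eEnergy_tail hfin)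
    simpa [Function.comp_def] using (this.const_mul (2 * M)).const_add (10 / M * A.toReal)
  have hXA : X.toReal ≤ 10 / M * A.toReal := by
    refine ge_of_tendsto hlim ?_
    obtain ⟨k₀, hk₀⟩ := exists_nat_ge (M + 3)
    filter_upwards [eventually_ge_atTop k₀] with k hk
    exact hbound (hk₀.trans (Nat.cast_le.2 hk))
  rw [hAX, ← ENNReal.ofReal_toReal hXfin]
  calc ENNReal.ofReal X.toReal ≤ ENNReal.ofReal (10 / M * A.toReal) :=
        ENNReal.ofReal_le_ofReal hXA
    _ = ENNReal.ofReal (10 / M) * A := by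
        rw [ENNReal.ofReal_mul (by positivity), ENNReal.ofReal_toReal hAfin]
    _ ≤ _ := by
        rw [ENNReal.ofReal_toReal hXfin]
        gcongr
        exact le_self_add

/-- **Energy decay improvement for minimizing maps (Lemma 2.2).** For any `α < 2` there
exist `δ > 0` and `R₁ > 1` such that for any `n0 ∈ S²` and any `S²`-valued energy
minimizing map `n` on `ℝ³∖B̄₁` with `∫ |n−n0|²/|x|² ≤ C_H ∫ |∇n|² < ∞`:
if `∫_{|x|≥1} |∇n|² ≤ δ²` then `(1/R₁)∫_{|x|≥R₁} |∇n|² ≤ (1/R₁^α) ∫_{|x|≥1} |∇n|²`. -/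
theorem energy_decay_improvement (α : ℝ) (hα : α < 2) (CH : ℝ) (hCH : 0 < CH) :
    ∃ δ : ℝ, 0 < δ ∧ ∃ R₁ : ℝ, 1 < R₁ ∧
      ∀ n0 : E3, ‖n0‖ = 1 → ∀ n : E3 → E3,
        UnitValuedOn n ExtB1 → (∀ x ∈ ExtB1, DifferentiableAt ℝ n x) →
        (∫⁻ x in ExtB1, (‖n x - n0‖₊ : ℝ≥0∞) ^ 2 / (‖x‖₊ : ℝ≥0∞) ^ 2)
          ≤ ENNReal.ofReal CH * eEnergy ExtB1 n →
        eEnergy ExtB1 n < ⊤ → MinimizingOn n ExtB1 →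
        eEnergy ExtB1 n ≤ ENNReal.ofReal (δ ^ 2) →
        eEnergy {x : E3 | R₁ ≤ ‖x‖} n
          ≤ ENNReal.ofReal (R₁ ^ (1 - α)) * eEnergy ExtB1 n := by
  have hlim := tendsto_rpow_atTop (show 0 < 2 - α by linarith)
  obtain ⟨R, hR20, hR11⟩ := ((hlim.eventually_ge_atTop 20).and (eventually_ge_atTop 11)).exists
  refine ⟨1, one_pos, R, by linarith, fun n0 _ n hunit hdiff _ hfin hmin _ => ?_⟩
  have h := eEnergy_exterior_le hunit hdiff hfin hmin (M := R - 3) (by linarith)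
  rw [sub_add_cancel] at h
  refine h.trans ?_
  gcongr
  have hR0 : 0 < R := by linarith
  rw [div_le_iff₀ (by linarith)]
  have e : R ^ (2 - α) = R ^ (1 - α) * R := by
    rw [← rpow_add_one hR0.ne']; ring_nf
  have hpos := rpow_pos_of_pos hR0 (1 - α)
  nlinarith

end
end
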